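/- Let k ≥ 2 and let T'_k = (σ₁σ₃)^{2k−2}(σ₃σ₄Δ₃)(Δ₃σ₄)[(δ₃σ₄)(δ̃₃σ₄)]^{k−1}(δ₃σ₄σ₃σ₄) ∈ B₅. Then T'_k is positive, ¬(Δ ≼ T'_k), T'_k ≼ Δ^{4k−1}, and ¬(T'_k ≼ Δ^{4k−2}); that is, inf T'_k = 0, sup T'_k = 4k−1, and the canonical length of T'_k is 4k−1, the same values as for T_k. -/

import Mathlib

/-- Defining relations of the braid group on 5 strands, as elements of the
free group on four generators (generator `i` corresponds to `σ_{i+1}`). -/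
def braidRels : Set (FreeGroup (Fin 4)) :=
  { r | (∃ i : Fin 3, r = FreeGroup.of i.castSucc * FreeGroup.of i.succ * FreeGroup.of i.castSucc *
          (FreeGroup.of i.succ * FreeGroup.of i.castSucc * FreeGroup.of i.succ)⁻¹) ∨
        (∃ i j : Fin 4, 2 ≤ |(i : ℤ) - (j : ℤ)| ∧
          r = FreeGroup.of i * FreeGroup.of j * (FreeGroup.of j * FreeGroup.of i)⁻¹) }

/-- The Artin braid group on 5 strands. -/
abbrev B5 : Type := PresentedGroup braidRels

/-- The Artin generators (index `i` corresponds to `σ_{i+1}`). -/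
def gen (i : Fin 4) : B5 := PresentedGroup.of i

def s1 : B5 := gen 0
def s2 : B5 := gen 1
def s3 : B5 := gen 2
def s4 : B5 := gen 3

/-- A braid is positive if it lies in the submonoid generated by `σ₁,…,σ₄`. -/
def IsPos (x : B5) : Prop := x ∈ Submonoid.closure (Set.range gen)

/-- Prefix order: `Pre x y` means `x ≼ y`, i.e. `x⁻¹ y` is positive. -/
def Pre (x y : B5) : Prop := IsPos (x⁻¹ * y)

/-- The half twist `Δ = σ₁σ₂σ₃σ₄σ₁σ₂σ₃σ₁σ₂σ₁`. -/
def Δ : B5 := s1*s2*s3*s4*s1*s2*s3*s1*s2*s1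

def δ3 : B5 := s2*s1
def Δ3 : B5 := s2*s1*s2
def δt3 : B5 := s1*s2

/-- A braid `s` is simple if `1 ≼ s ≼ Δ`. -/
def IsSimple (s : B5) : Prop := IsPos s ∧ Pre s Δ

/-- Two simple braids `s, t` are left-weighted if no generator `σᵢ` is such that
`s σᵢ` and `σᵢ⁻¹ t` are both simple. -/
def LeftWeighted (s t : B5) : Prop :=
  ¬ ∃ i : Fin 4, IsSimple (s * gen i) ∧ IsSimple ((gen i)⁻¹ * t)

/-- The canonical length of `z`: the minimum of `q - p` over `p ≤ q` with
`Δ^p ≼ z` and `z ≼ Δ^q`. -/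
noncomputable def canLen (z : B5) : ℕ :=
  sInf { n : ℕ | ∃ p q : ℤ, p ≤ q ∧ q - p = (n : ℤ) ∧ Pre (Δ ^ p) z ∧ Pre z (Δ ^ q) }

/-- `y` belongs to the super summit set of `x`:
`y` is conjugate to `x` and has minimal canonical length among conjugates of `x`. -/
def InSSS (x y : B5) : Prop :=
  IsConj x y ∧ ∀ z : B5, IsConj x z → canLen y ≤ canLen z

/-- The braid `T_k = δ₃^{3k+1} σ₄^{2k+2} σ₃ σ₄^{2k-1}`. -/
def T (k : ℕ) : B5 := δ3 ^ (3*k+1) * s4 ^ (2*k+2) * s3 * s4 ^ (2*k-1)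

/-- The braid `T'_k`, a rigid conjugate of `T_k`. -/
def T' (k : ℕ) : B5 :=
  (s1*s3)^(2*k-2) * (s3*s4*Δ3) * (Δ3*s4) * ((δ3*s4)*(δt3*s4))^(k-1) * (δ3*s4*s3*s4)

/-- The action of the generators of `B5` on `R¹⁰` given by the Lawrence–Krammer representation
with parameters `q = 2`, `t = 5`. The coordinates are indexed by the pairs
`12, 13, 14, 15, 23, 24, 25, 34, 35, 45`. -/
def krammer (R : Type*) [CommRing R] : Fin 4 → (Fin 10 → R) → Fin 10 → R
  | 0, v => ![20 * v 0 + 10 * v 1 + 10 * v 2 + 10 * v 3, v 4, v 5, v 6,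
      2 * v 1 - v 4, 2 * v 2 - v 5, 2 * v 3 - v 6, v 7, v 8, v 9]
  | 1, v => ![v 1 - v 0, 2 * v 0, v 2, v 3,
      20 * v 1 + 10 * v 2 + 10 * v 3 + 20 * v 4 + 10 * v 5 + 10 * v 6, v 7, v 8,
      2 * v 5 - v 7, 2 * v 6 - v 8, v 9]
  | 2, v => ![v 0, v 2 - v 1, 2 * v 1, v 3, v 5 - v 4, 2 * v 4, v 6,
      40 * v 2 + 20 * v 3 + 20 * v 5 + 10 * v 6 + 20 * v 7 + 10 * v 8, v 9, 2 * v 8 - v 9]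
  | 3, v => ![v 0, v 1, v 3 - v 2, 2 * v 2, v 4, v 6 - v 5, 2 * v 5, v 8 - v 7, 2 * v 7,
      80 * v 3 + 40 * v 6 + 20 * v 8 + 20 * v 9]

/-- The inverses of the maps `krammer ℚ i`. -/
def krammerInv : Fin 4 → (Fin 10 → ℚ) → Fin 10 → ℚ
  | 0, v => ![(v 0 - 5 * (v 1 + v 4) - 5 * (v 2 + v 5) - 5 * (v 3 + v 6)) / 20,
      (v 1 + v 4) / 2, (v 2 + v 5) / 2, (v 3 + v 6) / 2, v 1, v 2, v 3, v 7, v 8, v 9]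
  | 1, v => ![v 1 / 2, v 0 + v 1 / 2, v 2, v 3,
      (v 4 - 20 * (v 0 + v 1 / 2) - 10 * v 2 - 10 * v 3 - 5 * (v 5 + v 7) - 5 * (v 6 + v 8)) / 20,
      (v 5 + v 7) / 2, (v 6 + v 8) / 2, v 5, v 6, v 9]
  | 2, v => ![v 0, v 2 / 2, v 1 + v 2 / 2, v 3, v 5 / 2, v 4 + v 5 / 2, v 6,
      (v 7 - 40 * (v 1 + v 2 / 2) - 20 * v 3 - 20 * (v 4 + v 5 / 2) - 10 * v 6
        - 5 * (v 8 + v 9)) / 20, (v 8 + v 9) / 2, v 8]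
  | 3, v => ![v 0, v 1, v 3 / 2, v 2 + v 3 / 2, v 4, v 6 / 2, v 5 + v 6 / 2, v 8 / 2, v 7 + v 8 / 2,
      (v 9 - 80 * (v 2 + v 3 / 2) - 40 * (v 5 + v 6 / 2) - 20 * (v 7 + v 8 / 2)) / 20]

/-- The map `krammer ℚ i` as a permutation of `ℚ¹⁰`. -/
def krammerPerm (i : Fin 4) : Equiv.Perm (Fin 10 → ℚ) where
  toFun := krammer ℚ i
  invFun := krammerInv i
  left_inv v := by
    fin_cases i <;> ext j <;> fin_cases j <;> simp [krammer, krammerInv] <;> ring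
  right_inv v := by
    fin_cases i <;> ext j <;> fin_cases j <;> simp [krammer, krammerInv] <;> ring

theorem krammer_braid (i : Fin 3) (v : Fin 10 → ℚ) :
    krammer ℚ i.castSucc (krammer ℚ i.succ (krammer ℚ i.castSucc v)) =
      krammer ℚ i.succ (krammer ℚ i.castSucc (krammer ℚ i.succ v)) := by
  fin_cases i <;> ext j <;> fin_cases j <;> simp [krammer] <;> ring

theorem krammer_comm (i j : Fin 4) (h : 2 ≤ |(i : ℤ) - (j : ℤ)|) (v : Fin 10 → ℚ) :
    krammer ℚ i (krammer ℚ j v) = krammer ℚ j (krammer ℚ i v) := by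
  revert h
  fin_cases i <;> fin_cases j <;> intro h <;> first
    | (exfalso; revert h; decide)
    | (ext l; fin_cases l <;> simp [krammer] <;> ring)

/-- The Lawrence–Krammer action of `B5` on `ℚ¹⁰`. -/
def krammerHom : B5 →* Equiv.Perm (Fin 10 → ℚ) :=
  PresentedGroup.toGroup (f := krammerPerm) <| by
    rintro r (⟨i, rfl⟩ | ⟨i, j, h, rfl⟩)
    · rw [map_mul, map_inv, mul_inv_eq_one]
      ext1 v
      simp only [map_mul, FreeGroup.lift_apply_of, Equiv.Perm.mul_apply]
      exact krammer_braid i v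
    · rw [map_mul, map_inv, mul_inv_eq_one]
      ext1 v
      simp only [map_mul, FreeGroup.lift_apply_of, Equiv.Perm.mul_apply]
      exact krammer_comm i j h v

theorem krammerHom_gen (i : Fin 4) (v : Fin 10 → ℚ) : krammerHom (gen i) v = krammer ℚ i v := by
  simp [krammerHom, gen, krammerPerm]

/-- The braid represented by a positive word. -/
def posWord : FreeMonoid (Fin 4) →* B5 := FreeMonoid.lift gen

/-- The action of positive words on `R¹⁰`. -/
def wordAct (R : Type*) [CommRing R] : FreeMonoid (Fin 4) →* Function.End (Fin 10 → R) :=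
  FreeMonoid.lift (krammer R)

theorem isPos_iff {x : B5} : IsPos x ↔ ∃ w, posWord w = x := by
  rw [IsPos, ← FreeMonoid.mrange_lift]
  rfl

theorem krammer_map {R S : Type*} [CommRing R] [CommRing S] (f : R →+* S) (i : Fin 4)
    (v : Fin 10 → R) : krammer S i (f ∘ v) = f ∘ krammer R i v := by
  fin_cases i <;> ext j <;> fin_cases j <;>
    simp [krammer, map_ofNat f]

theorem wordAct_mul (R : Type*) [CommRing R] (u w : FreeMonoid (Fin 4)) (v : Fin 10 → R) :
    wordAct R (u * w) v = wordAct R u (wordAct R w v) := by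
  rw [map_mul]
  rfl

theorem wordAct_of (R : Type*) [CommRing R] (i : Fin 4) (v : Fin 10 → R) :
    wordAct R (FreeMonoid.of i) v = krammer R i v := rfl

theorem wordAct_map {R S : Type*} [CommRing R] [CommRing S] (f : R →+* S)
    (w : FreeMonoid (Fin 4)) (v : Fin 10 → R) : wordAct S w (f ∘ v) = f ∘ wordAct R w v := by
  induction w using FreeMonoid.inductionOn' with
  | one => rfl
  | of_mul i w ih =>
    rw [wordAct_mul, ih, wordAct_mul, wordAct_of, wordAct_of, krammer_map]

theorem krammerHom_posWord (w : FreeMonoid (Fin 4)) (v : Fin 10 → ℚ) :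
    krammerHom (posWord w) v = wordAct ℚ w v := by
  induction w using FreeMonoid.inductionOn' with
  | one => simp; rfl
  | of_mul i w ih =>
    rw [map_mul, map_mul, Equiv.Perm.mul_apply, ih, wordAct_mul, wordAct_of]
    exact krammerHom_gen i _

theorem wordAct_eq {u w : FreeMonoid (Fin 4)} (h : posWord u = posWord w) (v : Fin 10 → ℤ) :
    wordAct ℤ u v = wordAct ℤ w v := by
  have hu := krammerHom_posWord u (Int.castRingHom ℚ ∘ v)
  rw [h, krammerHom_posWord, wordAct_map, wordAct_map] at hu
  exact (funext fun j => Int.cast_injective (congrFun hu j)).symm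

/-- A word for the half twist. -/
def twist : FreeMonoid (Fin 4) := FreeMonoid.ofList [0, 1, 2, 3, 0, 1, 2, 0, 1, 0]

theorem posWord_twist : posWord twist = Δ := by
  simp [posWord, twist, Δ, s1, s2, s3, s4, FreeMonoid.lift_apply, mul_assoc]

theorem wordAct_twist (v : Fin 10 → ZMod 5) : wordAct (ZMod 5) twist v = 0 := by
  have h10 : (10 : ZMod 5) = 0 := rfl
  have h20 : (20 : ZMod 5) = 0 := rfl
  have h40 : (40 : ZMod 5) = 0 := rfl
  have h80 : (80 : ZMod 5) = 0 := rfl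
  change krammer _ 0 (krammer _ 1 (krammer _ 2 (krammer _ 3 (krammer _ 0 (krammer _ 1
    (krammer _ 2 (krammer _ 0 (krammer _ 1 (krammer _ 0 v))))))))) = 0
  ext j
  fin_cases j <;> simp [krammer, h10, h20, h40, h80]

theorem not_delta_mul {u : FreeMonoid (Fin 4)} {v : Fin 10 → ZMod 5}
    (h : wordAct (ZMod 5) u v ≠ 0) {y : B5} (hy : IsPos y) : posWord u ≠ Δ * y := by
  obtain ⟨w, rfl⟩ := isPos_iff.1 hy
  rw [← posWord_twist, ← map_mul]
  intro e
  apply h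
  have hv : v = Int.castRingHom (ZMod 5) ∘ fun j => ((v j).val : ℤ) := by ext; simp
  rw [hv, wordAct_map, wordAct_eq e, ← wordAct_map, wordAct_mul, wordAct_twist]

/-- Divide a word on the left by a generator, by reversing. -/
def pull : ℕ → Fin 4 → List (Fin 4) → Option (List (Fin 4))
  | 0, _, _ => none
  | _ + 1, _, [] => none
  | n + 1, a, b :: u =>
    if a = b then some u
    else if (a : ℕ) + 1 = b ∨ (b : ℕ) + 1 = a then
      ((pull n a u).bind (pull n b)).map (fun r => b :: a :: r)
    else (pull n a u).map (b :: ·)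

/-- Divide the first word on the left by the second one. -/
def divide : List (Fin 4) → List (Fin 4) → Option (List (Fin 4))
  | u, [] => some u
  | u, a :: w => (pull u.length a u).bind fun r => divide r w

/-- The braid represented by a list of generators. -/
def braid (u : List (Fin 4)) : B5 := posWord (FreeMonoid.ofList u)

theorem braid_nil : braid [] = 1 := rfl

theorem braid_cons (a : Fin 4) (u : List (Fin 4)) : braid (a :: u) = gen a * braid u := by
  simp [braid, posWord, FreeMonoid.lift_ofList]

theorem braid_append (u w : List (Fin 4)) : braid (u ++ w) = braid u * braid w := by
  simp [braid, posWord, FreeMonoid.lift_ofList]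

theorem gen_braid (i : Fin 3) :
    gen i.castSucc * gen i.succ * gen i.castSucc = gen i.succ * gen i.castSucc * gen i.succ := by
  have h := PresentedGroup.one_of_mem (rels := braidRels) (Or.inl ⟨i, rfl⟩)
  rwa [map_mul, map_inv, mul_inv_eq_one] at h

theorem gen_comm {i j : Fin 4} (hij : 2 ≤ |(i : ℤ) - (j : ℤ)|) :
    gen i * gen j = gen j * gen i := by
  have h := PresentedGroup.one_of_mem (rels := braidRels) (Or.inr ⟨i, j, hij, rfl⟩)
  rwa [map_mul, map_inv, mul_inv_eq_one] at h

theorem gen_braid' {a b : Fin 4} (h : (a : ℕ) + 1 = b ∨ (b : ℕ) + 1 = a) :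
    gen a * gen b * gen a = gen b * gen a * gen b := by
  rcases h with h | h
  · obtain ⟨i, rfl, rfl⟩ : ∃ i : Fin 3, a = i.castSucc ∧ b = i.succ :=
      ⟨⟨a, by omega⟩, rfl, Fin.ext h.symm⟩
    exact gen_braid i
  · obtain ⟨i, rfl, rfl⟩ : ∃ i : Fin 3, b = i.castSucc ∧ a = i.succ :=
      ⟨⟨b, by omega⟩, rfl, Fin.ext h.symm⟩
    exact (gen_braid i).symm

theorem braid_of_pull {n : ℕ} {a : Fin 4} {u r : List (Fin 4)} (h : pull n a u = some r) :
    braid u = gen a * braid r := by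
  induction n generalizing a u r with
  | zero => simp [pull] at h
  | succ n ih =>
    cases u with
    | nil => simp [pull] at h
    | cons b u =>
      rw [pull] at h
      split_ifs at h with hab hadj
      · obtain rfl := Option.some.inj h
        rw [braid_cons, hab]
      · simp only [Option.map_eq_some_iff, Option.bind_eq_some_iff] at h
        obtain ⟨s, ⟨s', h₁, h₂⟩, rfl⟩ := h
        rw [braid_cons, ih h₁, ih h₂, braid_cons, braid_cons]
        simpa only [mul_assoc] using congrArg (· * braid s) (gen_braid' hadj).symm
      · simp only [Option.map_eq_some_iff] at h
        obtain ⟨s, h₁, rfl⟩ := h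
        have hc : gen a * gen b = gen b * gen a := by
          apply gen_comm
          rw [Fin.ext_iff] at hab
          rw [le_abs]
          omega
        rw [braid_cons, ih h₁, braid_cons, ← mul_assoc, ← mul_assoc, hc]

theorem braid_of_divide {u w r : List (Fin 4)} (h : divide u w = some r) :
    braid u = braid w * braid r := by
  induction w generalizing u with
  | nil =>
    obtain rfl := Option.some.inj h
    rw [braid_nil, one_mul]
  | cons a w ih =>
    simp only [divide, Option.bind_eq_some_iff] at h
    obtain ⟨s, h₁, h₂⟩ := h
    rw [braid_of_pull h₁, ih h₂, braid_cons, mul_assoc]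

theorem braid_eq {u w : List (Fin 4)} (h : divide u w = some []) : braid u = braid w := by
  rw [braid_of_divide h, braid_nil, mul_one]

theorem gen_mul_delta (i : Fin 4) : gen i * Δ = Δ * gen i.rev := by
  have h : ∀ i : Fin 4, divide (i :: [0, 1, 2, 3, 0, 1, 2, 0, 1, 0])
      ([0, 1, 2, 3, 0, 1, 2, 0, 1, 0] ++ [i.rev]) = some [] := by decide
  have e := braid_eq (h i)
  rw [braid_append, braid_cons i, braid_cons i.rev, braid_nil, mul_one] at e
  rw [← posWord_twist]
  exact e

theorem posWord_mul_delta (w : FreeMonoid (Fin 4)) :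
    posWord w * Δ = Δ * posWord (FreeMonoid.map Fin.rev w) := by
  induction w using FreeMonoid.inductionOn' with
  | one => simp
  | of_mul i w ih =>
    have h : ∀ i, posWord (FreeMonoid.of i) = gen i := fun _ => rfl
    rw [map_mul, map_mul, map_mul, mul_assoc, ih, ← mul_assoc, FreeMonoid.map_of, h, h,
      gen_mul_delta, mul_assoc]

theorem map_rev_map_rev (w : FreeMonoid (Fin 4)) :
    FreeMonoid.map Fin.rev (FreeMonoid.map Fin.rev w) = w := by
  rw [← MonoidHom.comp_apply, ← FreeMonoid.map_comp, Fin.rev_involutive.comp_self,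
    FreeMonoid.map_id, MonoidHom.id_apply]

theorem delta_mul_posWord (w : FreeMonoid (Fin 4)) :
    Δ * posWord w = posWord (FreeMonoid.map Fin.rev w) * Δ := by
  rw [posWord_mul_delta, map_rev_map_rev]

theorem commute_delta_sq (w : FreeMonoid (Fin 4)) : Commute (Δ ^ 2) (posWord w) := by
  rw [commute_iff_eq, sq, mul_assoc, delta_mul_posWord, ← mul_assoc, delta_mul_posWord,
    map_rev_map_rev, mul_assoc]

theorem IsPos.mul {x y : B5} (hx : IsPos x) (hy : IsPos y) : IsPos (x * y) :=
  Submonoid.mul_mem _ hx hy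

theorem isPos_delta_pow (n : ℕ) : IsPos (Δ ^ n) :=
  Submonoid.pow_mem _ (isPos_iff.2 ⟨twist, posWord_twist⟩) n

theorem IsPos.delta_conj {x : B5} (hx : IsPos x) (n : ℕ) : IsPos (Δ ^ n * x * (Δ ^ n)⁻¹) := by
  induction n with
  | zero => simpa using hx
  | succ n ih =>
    obtain ⟨w, hw⟩ := isPos_iff.1 ih
    refine isPos_iff.2 ⟨FreeMonoid.map Fin.rev w, ?_⟩
    rw [eq_mul_inv_of_mul_eq (delta_mul_posWord w).symm, hw, pow_succ']
    group

theorem IsPos.delta_inv_conj {x : B5} (hx : IsPos x) (n : ℕ) :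
    IsPos ((Δ ^ n)⁻¹ * x * Δ ^ n) := by
  induction n with
  | zero => simpa using hx
  | succ n ih =>
    obtain ⟨w, hw⟩ := isPos_iff.1 ih
    refine isPos_iff.2 ⟨FreeMonoid.map Fin.rev w, ?_⟩
    rw [eq_inv_mul_of_mul_eq (posWord_mul_delta w).symm, hw, pow_succ]
    group

/-- The infimum, supremum and canonical length of a positive braid `x` with left complement
`Δ ^ (r + 1) * x⁻¹` positive, if neither acts as zero modulo `5`. -/
theorem inf_sup_canLen {x : B5} {r : ℕ} {u w : FreeMonoid (Fin 4)} {a b : Fin 10 → ZMod 5}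
    (hu : posWord u = x) (hw : posWord w * x = Δ ^ (r + 1))
    (ha : wordAct (ZMod 5) u a ≠ 0) (hb : wordAct (ZMod 5) w b ≠ 0) :
    IsPos x ∧ ¬ Pre Δ x ∧ Pre x (Δ ^ (r + 1)) ∧ ¬ Pre x (Δ ^ r) ∧
    IsGreatest { p : ℤ | Pre (Δ ^ p) x } 0 ∧
    IsLeast { q : ℤ | Pre x (Δ ^ q) } ((r : ℤ) + 1) ∧ canLen x = r + 1 := by
  have hpos : IsPos x := isPos_iff.2 ⟨u, hu⟩
  have hinf : ¬ Pre Δ x := fun h => not_delta_mul ha h (by rw [hu, mul_inv_cancel_left])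
  have hx : x = (posWord w)⁻¹ * Δ ^ (r + 1) := eq_inv_mul_of_mul_eq hw
  have hle : Pre x (Δ ^ (r + 1)) := by
    have h := (isPos_iff.2 ⟨w, rfl⟩ : IsPos (posWord w)).delta_inv_conj (r + 1)
    rw [Pre, hx]
    convert h using 1
    group
  have hsup : ¬ Pre x (Δ ^ r) := fun h => by
    refine not_delta_mul hb (IsPos.delta_conj h r) ?_
    rw [hx, pow_succ']
    group
  have hp : ∀ p : ℤ, Pre (Δ ^ p) x → p ≤ 0 := fun p h => by
    by_contra! hp
    obtain ⟨n, rfl⟩ : ∃ n : ℕ, p = n + 1 := ⟨(p - 1).toNat, by omega⟩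
    apply hinf
    have := (isPos_delta_pow n).mul h
    rw [Pre]
    convert this using 1
    group
  have hq : ∀ q : ℤ, Pre x (Δ ^ q) → (r : ℤ) + 1 ≤ q := fun q h => by
    by_contra! hq
    obtain ⟨n, hn⟩ : ∃ n : ℕ, (r : ℤ) = q + n := ⟨(r - q).toNat, by omega⟩
    apply hsup
    have := IsPos.mul h (isPos_delta_pow n)
    rw [Pre]
    convert this using 1
    rw [mul_assoc, ← zpow_natCast, ← zpow_natCast, ← zpow_add, hn]
  have h0 : Pre (Δ ^ (0 : ℤ)) x := by simpa [Pre] using hpos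
  have hle' : Pre x (Δ ^ ((r : ℤ) + 1)) := by exact_mod_cast hle
  refine ⟨hpos, hinf, hle, hsup, ⟨h0, fun p => hp p⟩, ⟨hle', fun q => hq q⟩, ?_⟩
  refine le_antisymm (Nat.sInf_le ⟨0, r + 1, by omega, by simp, h0, hle'⟩) ?_
  refine le_csInf ⟨r + 1, 0, r + 1, by omega, by simp, h0, hle'⟩ ?_
  rintro n ⟨p, q, -, hn, h₁, h₂⟩
  have := hp p h₁
  have := hq q h₂
  omega

theorem complement_mul {a b c s a' b' c' s' : FreeMonoid (Fin 4)} (n m : ℕ)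
    (ha : posWord a' * posWord a = Δ ^ 2) (hb : posWord b' * posWord b = Δ ^ 2)
    (hc : posWord c' * posWord c = Δ ^ 2) (hs : posWord s' * posWord s = Δ) :
    posWord (s' * c' ^ m * b' * a' ^ n) * posWord (a ^ n * b * c ^ m * s) =
      Δ ^ (2 * n + 2 * m + 2 + 1) := by
  have key : ∀ (x x' : FreeMonoid (Fin 4)) (n : ℕ), posWord x' * posWord x = Δ ^ 2 →
      posWord x' ^ n * posWord x ^ n = Δ ^ (2 * n) := fun x x' n h => by
    have hcomm : Commute (posWord x') (posWord x) := by
      rw [commute_iff_eq, h]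
      have := commute_delta_sq x
      rw [← h] at this
      rw [← h]
      exact mul_right_cancel (this.eq.trans (mul_assoc _ _ _).symm)
    rw [← hcomm.mul_pow, h, pow_mul]
  have central : ∀ (n : ℕ) (w : FreeMonoid (Fin 4)),
      posWord w * Δ ^ (2 * n) = Δ ^ (2 * n) * posWord w := fun n w => by
    rw [pow_mul]
    exact ((commute_delta_sq w).pow_left n).eq.symm
  simp only [map_mul, map_pow]
  calc _ = posWord s' * (posWord c' ^ m * (posWord b' * (posWord a' ^ n * posWord a ^ n) *
        posWord b) * posWord c ^ m) * posWord s := by simp only [mul_assoc]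
    _ = Δ ^ (2 * n) * (posWord s' * (posWord c' ^ m * (posWord b' * posWord b) *
        posWord c ^ m) * posWord s) := by
      rw [key a a' n ha]
      simp only [← map_pow, ← mul_assoc, central]
    _ = Δ ^ (2 * n) * (Δ ^ 2 * (posWord s' * (posWord c' ^ m * posWord c ^ m) * posWord s)) := by
      rw [hb]
      have := central 1
      simp only [mul_one] at this
      simp only [← map_pow, ← mul_assoc, this]
    _ = Δ ^ (2 * n) * (Δ ^ 2 * (Δ ^ (2 * m) * Δ)) := by
      rw [key c c' m hc, central, mul_assoc, hs]
    _ = _ := by simp only [← pow_add, ← pow_succ]; congr 1; omega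

theorem wordAct_pow_mem {R : Type*} [CommRing R] (w : FreeMonoid (Fin 4)) {S : Set (Fin 10 → R)}
    (hS : ∀ v ∈ S, wordAct R w v ∈ S) {v : Fin 10 → R} (hv : v ∈ S) (n : ℕ) :
    wordAct R (w ^ n) v ∈ S := by
  induction n with
  | zero => exact hv
  | succ n ih =>
    rw [pow_succ', wordAct_mul]
    exact hS _ ih

theorem posWord_mul_posWord_eq {u w : List (Fin 4)} {n : ℕ}
    (h : divide (u ++ w) (List.replicate n [0, 1, 2, 3, 0, 1, 2, 0, 1, 0]).flatten = some []) :
    posWord (FreeMonoid.ofList u) * posWord (FreeMonoid.ofList w) = Δ ^ n := by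
  have hn : ∀ n, braid (List.replicate n [0, 1, 2, 3, 0, 1, 2, 0, 1, 0]).flatten = Δ ^ n := by
    intro n
    induction n with
    | zero => rfl
    | succ n ih =>
      rw [List.replicate_succ, List.flatten_cons, braid_append, ih, pow_succ', ← posWord_twist]
      rfl
  exact (braid_append u w).symm.trans ((braid_eq h).trans (hn n))

/-- A positive word for `T' (m + 2)`. -/
def wordT' (m : ℕ) : FreeMonoid (Fin 4) :=
  FreeMonoid.ofList [0, 2, 0, 2] ^ (m + 1) * FreeMonoid.ofList [2, 3, 1, 0, 1, 1, 0, 1, 3] *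
    FreeMonoid.ofList [1, 0, 3, 0, 1, 3] ^ (m + 1) * FreeMonoid.ofList [1, 0, 3, 2, 3]

/-- A positive word for the left complement of `T' (m + 2)`. -/
def compT' (m : ℕ) : FreeMonoid (Fin 4) :=
  FreeMonoid.ofList [2, 3, 1, 2, 0] *
    FreeMonoid.ofList [0, 2, 1, 0, 3, 2, 1, 2, 1, 2, 3, 0, 1, 2] ^ (m + 1) *
    FreeMonoid.ofList [2, 1, 0, 3, 2, 1, 1, 2, 3, 0, 1] *
    FreeMonoid.ofList [1, 0, 2, 1, 3, 2, 1, 0, 2, 3, 1, 2, 0, 1, 2, 3] ^ (m + 1)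

/-- A positive word for `T (m + 2)`, in which the powers of simple braids are visible. -/
def wordT (m : ℕ) : FreeMonoid (Fin 4) :=
  FreeMonoid.ofList [1, 0, 1, 3, 1, 0, 1, 3] ^ (m + 2) * FreeMonoid.ofList [1, 0, 3, 2, 3, 2, 3] *
    FreeMonoid.ofList [3, 3] ^ m * FreeMonoid.ofList [3]

/-- A positive word for the left complement of `T (m + 2)`. -/
def compT (m : ℕ) : FreeMonoid (Fin 4) :=
  FreeMonoid.ofList [1, 2, 3, 0, 1, 2, 0, 1, 0] *
    FreeMonoid.ofList [0, 1, 0, 2, 1, 0, 3, 2, 1, 3, 2, 3, 1, 2, 3, 0, 1, 2] ^ m *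
    FreeMonoid.ofList [0, 1, 0, 2, 1, 0, 3, 2, 2, 3, 1, 2, 0] *
    FreeMonoid.ofList [2, 1, 0, 3, 2, 1, 1, 2, 3, 0, 1, 2] ^ (m + 2)

set_option maxRecDepth 10000 in
theorem compT'_mul (m : ℕ) : posWord (compT' m) * posWord (wordT' m) = Δ ^ (4 * m + 6 + 1) := by
  rw [compT', wordT', complement_mul]
  · congr 1; omega
  all_goals first
    | exact posWord_mul_posWord_eq (by decide)
    | exact (posWord_mul_posWord_eq (n := 1) (by decide)).trans (pow_one _)

set_option maxRecDepth 10000 in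
theorem compT_mul (m : ℕ) : posWord (compT m) * posWord (wordT m) = Δ ^ (4 * m + 6 + 1) := by
  rw [compT, wordT, complement_mul]
  · congr 1; omega
  all_goals first
    | exact posWord_mul_posWord_eq (by decide)
    | exact (posWord_mul_posWord_eq (n := 1) (by decide)).trans (pow_one _)

theorem posWord_wordT' (m : ℕ) : posWord (wordT' m) = T' (m + 2) := by
  have h₁ : 2 * (m + 2) - 2 = 2 * (m + 1) := by omega
  have h₂ : m + 2 - 1 = m + 1 := by omega
  rw [T', h₁, h₂, pow_mul]
  simp [wordT', posWord, δ3, Δ3, δt3, s1, s2, s3, s4, mul_assoc, sq]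

theorem posWord_wordT (m : ℕ) : posWord (wordT m) = T (m + 2) := by
  have hm : 2 * (m + 2) - 1 = 1 + 1 + 2 * m + 1 := by omega
  have hd : braid [1, 0, 1, 0, 1, 0] = δ3 ^ 3 := by
    simp [braid_cons, braid_nil, δ3, s1, s2, pow_succ, mul_assoc]
  have hs : braid [3, 3] = s4 ^ 2 := by
    simp [braid_cons, braid_nil, s4, pow_succ]
  have hB : braid [1, 0, 1, 3, 1, 0, 1, 3] = δ3 ^ 3 * s4 ^ 2 := by
    rw [← hd, ← hs, ← braid_append]
    exact braid_eq (by decide)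
  have hcomm : Commute (δ3 ^ 3) (s4 ^ 2) := by
    rw [← hd, ← hs, commute_iff_eq, ← braid_append, ← braid_append]
    exact braid_eq (by decide)
  have hFG : braid [1, 0, 3, 2, 3, 2, 3] = δ3 * s4 ^ 2 * s3 * s4 ^ 2 := by
    have : braid [1, 0, 3, 3, 2, 3, 3] = δ3 * s4 ^ 2 * s3 * s4 ^ 2 := by
      simp [braid_cons, braid_nil, δ3, s1, s2, s3, s4, pow_succ, mul_assoc]
    rw [← this]
    exact braid_eq (by decide)
  have hcomm' : Commute δ3 (s4 ^ 2) := by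
    have : braid [1, 0] = δ3 := by simp [braid_cons, braid_nil, δ3, s1, s2]
    rw [← this, ← hs, commute_iff_eq, ← braid_append, ← braid_append]
    exact braid_eq (by decide)
  rw [wordT, map_mul, map_mul, map_mul, map_pow, map_pow]
  change braid _ ^ (m + 2) * braid _ * braid _ ^ m * braid _ = _
  rw [hB, hcomm.mul_pow, hFG, hs, braid_cons, braid_nil, T, hm]
  have e := ((hcomm'.pow_right (m + 2)).eq).symm
  calc (δ3 ^ 3) ^ (m + 2) * (s4 ^ 2) ^ (m + 2) * (δ3 * s4 ^ 2 * s3 * s4 ^ 2) * (s4 ^ 2) ^ m *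
        (gen 3 * 1)
      = (δ3 ^ 3) ^ (m + 2) * ((s4 ^ 2) ^ (m + 2) * δ3) * s4 ^ 2 * s3 * s4 ^ 2 * (s4 ^ 2) ^ m *
        s4 := by simp only [mul_assoc, mul_one, s4]
    _ = _ := by
      rw [e]
      simp only [pow_mul, pow_add, pow_one, sq, mul_assoc]

set_option maxRecDepth 100000 in
theorem wordAct_wordT'_ne_zero (m : ℕ) : ∃ a, wordAct (ZMod 5) (wordT' m) a ≠ 0 := by
  refine ⟨![0, 1, 0, 0, 3, 0, 0, 0, 0, 0], fun h => ?_⟩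
  rw [wordT', wordAct_mul, wordAct_mul, wordAct_mul] at h
  have h₁ : wordAct (ZMod 5) (FreeMonoid.ofList [1, 0, 3, 0, 1, 3] ^ (m + 1))
      (wordAct (ZMod 5) (FreeMonoid.ofList [1, 0, 3, 2, 3]) ![0, 1, 0, 0, 3, 0, 0, 0, 0, 0]) ∈
      ({![2, 0, 4, 2, 0, 0, 0, 4, 2, 0], ![3, 0, 0, 1, 0, 0, 4, 0, 3, 0],
        ![2, 0, 1, 3, 0, 0, 0, 1, 3, 0], ![3, 0, 0, 4, 0, 0, 1, 0, 2, 0]} :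
        Set (Fin 10 → ZMod 5)) := by
    apply wordAct_pow_mem
    · simp only [Set.mem_insert_iff, Set.mem_singleton_iff]
      rintro v (rfl | rfl | rfl | rfl) <;> decide
    · left; decide
  have hS : ∀ v ∈ {v : Fin 10 → ZMod 5 | 2 * v 8 + v 9 ≠ 0},
      wordAct (ZMod 5) (FreeMonoid.ofList [0, 2, 0, 2]) v ∈
        {v : Fin 10 → ZMod 5 | 2 * v 8 + v 9 ≠ 0} := fun v hv => by
    have e : wordAct (ZMod 5) (FreeMonoid.ofList [0, 2, 0, 2]) v = krammer _ 0 (krammer _ 2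
      (krammer _ 0 (krammer _ 2 v))) := rfl
    rw [Set.mem_ofPred_eq] at hv ⊢
    rw [e]
    convert hv using 1
    simp [krammer]
    ring
  refine wordAct_pow_mem _ hS (v := wordAct (ZMod 5) (FreeMonoid.ofList [2, 3, 1, 0, 1, 1, 0, 1, 3])
    (wordAct (ZMod 5) (FreeMonoid.ofList [1, 0, 3, 0, 1, 3] ^ (m + 1))
      (wordAct (ZMod 5) (FreeMonoid.ofList [1, 0, 3, 2, 3]) ![0, 1, 0, 0, 3, 0, 0, 0, 0, 0])))
    ?_ (m + 1) ?_
  · simp only [Set.mem_insert_iff, Set.mem_singleton_iff] at h₁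
    rcases h₁ with h₁ | h₁ | h₁ | h₁ <;> rw [h₁] <;> change ¬ _ <;> decide
  · rw [h]
    simp

set_option maxRecDepth 100000 in
theorem wordAct_compT'_ne_zero (m : ℕ) : ∃ a, wordAct (ZMod 5) (compT' m) a ≠ 0 := by
  refine ⟨![0, 0, 0, 0, 0, 0, 0, 1, 0, 0], fun h => ?_⟩
  rw [compT', wordAct_mul, wordAct_mul, wordAct_mul] at h
  have h₁ := wordAct_pow_mem (FreeMonoid.ofList [1, 0, 2, 1, 3, 2, 1, 0, 2, 3, 1, 2, 0, 1, 2, 3])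
    (S := ({![0, 0, 0, 0, 0, 0, 0, 1, 0, 0], ![0, 0, 0, 0, 0, 0, 0, 4, 0, 0]} :
      Set (Fin 10 → ZMod 5)))
    (by
      simp only [Set.mem_insert_iff, Set.mem_singleton_iff]
      rintro v (rfl | rfl) <;> decide) (Or.inl rfl) (m + 1)
  have h₂ := wordAct_pow_mem (FreeMonoid.ofList [0, 2, 1, 0, 3, 2, 1, 2, 1, 2, 3, 0, 1, 2])
    (S := ({![0, 1, 0, 0, 1, 0, 0, 0, 0, 1], ![0, 1, 0, 0, 1, 0, 0, 0, 0, 4],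
      ![0, 4, 0, 0, 4, 0, 0, 0, 0, 1], ![0, 4, 0, 0, 4, 0, 0, 0, 0, 4]} :
      Set (Fin 10 → ZMod 5)))
    (by
      simp only [Set.mem_insert_iff, Set.mem_singleton_iff]
      rintro v (rfl | rfl | rfl | rfl) <;> decide)
    (v := wordAct (ZMod 5) (FreeMonoid.ofList [2, 1, 0, 3, 2, 1, 1, 2, 3, 0, 1])
      (wordAct (ZMod 5)
        (FreeMonoid.ofList [1, 0, 2, 1, 3, 2, 1, 0, 2, 3, 1, 2, 0, 1, 2, 3] ^ (m + 1))
        ![0, 0, 0, 0, 0, 0, 0, 1, 0, 0]))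
    (by
      simp only [Set.mem_insert_iff, Set.mem_singleton_iff] at h₁ ⊢
      rcases h₁ with h₁ | h₁ <;> rw [h₁] <;> decide) (m + 1)
  simp only [Set.mem_insert_iff, Set.mem_singleton_iff] at h₂
  rcases h₂ with h₂ | h₂ | h₂ | h₂ <;> rw [h₂] at h <;> revert h <;> decide

set_option maxRecDepth 100000 in
theorem wordAct_wordT_ne_zero (m : ℕ) : ∃ a, wordAct (ZMod 5) (wordT m) a ≠ 0 := by
  refine ⟨![0, 0, 0, 0, 1, 0, 0, 0, 0, 0], fun h => ?_⟩
  rw [wordT, wordAct_mul, wordAct_mul, wordAct_mul] at h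
  have h₁ := wordAct_pow_mem (FreeMonoid.ofList [3, 3])
    (S := ({![0, 0, 0, 0, 1, 0, 0, 0, 0, 0]} : Set (Fin 10 → ZMod 5)))
    (by rintro v rfl; decide) rfl m
  rw [Set.mem_singleton_iff] at h₁
  have h₀ : wordAct (ZMod 5) (FreeMonoid.ofList [3]) ![0, 0, 0, 0, 1, 0, 0, 0, 0, 0] =
    ![0, 0, 0, 0, 1, 0, 0, 0, 0, 0] := by decide
  rw [h₀, h₁] at h
  let S := {v : Fin 10 → ZMod 5 | 4 * (v 2 + v 3) + 2 * (v 5 + v 6) + (v 7 + v 8) ≠ 0}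
  have key : ∀ i ∈ ({0, 1, 3} : Set (Fin 4)), ∀ v ∈ S, krammer (ZMod 5) i v ∈ S := by
    rintro i (rfl | rfl | rfl) v hv <;> rw [Set.mem_ofPred_eq] at hv ⊢ <;> convert hv using 1 <;>
      simp [krammer] <;> ring
  have hS : ∀ v ∈ S, wordAct (ZMod 5) (FreeMonoid.ofList [1, 0, 1, 3, 1, 0, 1, 3]) v ∈ S :=
    fun v hv =>
      have h0 := key 0 (by simp)
      have h1 := key 1 (by simp)
      have h3 := key 3 (by simp)
      h1 _ (h0 _ (h1 _ (h3 _ (h1 _ (h0 _ (h1 _ (h3 _ hv)))))))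
  refine wordAct_pow_mem _ hS (v := wordAct (ZMod 5) (FreeMonoid.ofList [1, 0, 3, 2, 3, 2, 3])
    ![0, 0, 0, 0, 1, 0, 0, 0, 0, 0]) ?_ (m + 2) ?_
  · change ¬ _
    decide
  · rw [h]
    simp

set_option maxRecDepth 100000 in
theorem wordAct_compT_ne_zero (m : ℕ) : ∃ a, wordAct (ZMod 5) (compT m) a ≠ 0 := by
  refine ⟨![0, 0, 0, 0, 1, 0, 0, 0, 0, 0], fun h => ?_⟩
  rw [compT, wordAct_mul, wordAct_mul, wordAct_mul] at h
  have h₁ := wordAct_pow_mem (FreeMonoid.ofList [2, 1, 0, 3, 2, 1, 1, 2, 3, 0, 1, 2])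
    (S := ({![0, 0, 0, 0, 1, 0, 0, 0, 0, 0]} : Set (Fin 10 → ZMod 5)))
    (by rintro v rfl; decide) rfl (m + 2)
  have h₂ := wordAct_pow_mem
    (FreeMonoid.ofList [0, 1, 0, 2, 1, 0, 3, 2, 1, 3, 2, 3, 1, 2, 3, 0, 1, 2])
    (S := ({![0, 0, 0, 0, 0, 0, 0, 0, 0, 1], ![0, 0, 0, 0, 0, 0, 0, 0, 0, 4]} :
      Set (Fin 10 → ZMod 5)))
    (by
      simp only [Set.mem_insert_iff, Set.mem_singleton_iff]
      rintro v (rfl | rfl) <;> decide)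
    (v := wordAct (ZMod 5) (FreeMonoid.ofList [0, 1, 0, 2, 1, 0, 3, 2, 2, 3, 1, 2, 0])
      (wordAct (ZMod 5) (FreeMonoid.ofList [2, 1, 0, 3, 2, 1, 1, 2, 3, 0, 1, 2] ^ (m + 2))
        ![0, 0, 0, 0, 1, 0, 0, 0, 0, 0]))
    (by
      rw [Set.mem_singleton_iff] at h₁
      rw [h₁]
      left; decide) m
  simp only [Set.mem_insert_iff, Set.mem_singleton_iff] at h₂
  rcases h₂ with h₂ | h₂ <;> rw [h₂] at h <;> revert h <;> decide

/-- `T'_k` is positive, `Δ` is not a prefix of `T'_k`, `T'_k ≼ Δ^{4k-1}`,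
`¬(T'_k ≼ Δ^{4k-2})`; that is, `inf T'_k = 0`, `sup T'_k = 4k-1` and the canonical
length of `T'_k` is `4k-1`, the same values as for `T_k`. -/
theorem T'k_inf_sup_len (k : ℕ) (hk : 2 ≤ k) :
    IsPos (T' k) ∧ ¬ Pre Δ (T' k) ∧ Pre (T' k) (Δ ^ (4*k-1)) ∧ ¬ Pre (T' k) (Δ ^ (4*k-2)) ∧
    IsGreatest { p : ℤ | Pre (Δ ^ p) (T' k) } 0 ∧
    IsLeast { q : ℤ | Pre (T' k) (Δ ^ q) } (4*(k:ℤ) - 1) ∧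
    canLen (T' k) = 4*k - 1 ∧
    canLen (T' k) = canLen (T k) := by
  obtain ⟨m, rfl⟩ : ∃ m, k = m + 2 := ⟨k - 2, by omega⟩
  obtain ⟨a, ha⟩ := wordAct_wordT'_ne_zero m
  obtain ⟨b, hb⟩ := wordAct_compT'_ne_zero m
  obtain ⟨c, hc⟩ := wordAct_wordT_ne_zero m
  obtain ⟨d, hd⟩ := wordAct_compT_ne_zero m
  have e₁ : 4 * (m + 2) - 1 = 4 * m + 6 + 1 := by omega
  have e₂ : 4 * (m + 2) - 2 = 4 * m + 6 := by omega
  have e₃ : 4 * ((m + 2 : ℕ) : ℤ) - 1 = ((4 * m + 6 : ℕ) : ℤ) + 1 := by push_cast; ring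
  obtain ⟨h₁, h₂, h₃, h₄, h₅, h₆, h₇⟩ :=
    inf_sup_canLen (posWord_wordT' m) (by rw [← posWord_wordT', compT'_mul]) ha hb
  obtain ⟨-, -, -, -, -, -, hT⟩ :=
    inf_sup_canLen (posWord_wordT m) (by rw [← posWord_wordT, compT_mul]) hc hd
  rw [e₁, e₂, e₃]
  exact ⟨h₁, h₂, h₃, h₄, h₅, h₆, h₇, h₇.trans hT.symm⟩
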